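/- Let H_i ∈ ℂ^{m_i×n} for i = 1,...,N and ω_i ≥ 0, and let ξ ≥ (1/2) N² Σ-free per-user constants ξ_i = (1/2) N² λ_max(H_iᴴH_i)². Then for every i and for all N-tuples of Hermitian PSD matrices (S_ℓ) and (S_ℓ^{(0)}): log det(I + H_i (Σ_k S_k) H_iᴴ) ≥ log det(I + H_i (Σ_k S_k^{(0)}) H_iᴴ) + Σ_ℓ Re Tr(G_i (S_ℓ − S_ℓ^{(0)})) − ξ_i Σ_ℓ Tr((S_ℓ − S_ℓ^{(0)})ᴴ(S_ℓ − S_ℓ^{(0)})), where G_i = H_iᴴ(I + H_i Σ_k S_k^{(0)} H_iᴴ)⁻¹ H_i. -/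

import Mathlib

open Matrix ComplexOrder

section helpers

variable {ι : Type*} [Fintype ι] [DecidableEq ι]

open scoped MatrixOrder in
lemma psd_factor {Q : Matrix ι ι ℂ} (hQ : Q.PosSemidef) : ∃ B : Matrix ι ι ℂ, Q = Bᴴ * B :=
  CStarAlgebra.nonneg_iff_eq_star_mul_self.mp hQ.nonneg

lemma trace_mul_psd_nonneg {P Q : Matrix ι ι ℂ} (hP : P.PosSemidef) (hQ : Q.PosSemidef) :
    0 ≤ (trace (P * Q)).re := by
  obtain ⟨B, rfl⟩ := psd_factor hQ
  have h := (hP.mul_mul_conjTranspose_same B).trace_nonneg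
  rw [Matrix.mul_assoc, Matrix.trace_mul_comm, Matrix.mul_assoc] at h
  exact (Complex.le_def.1 h).1

lemma trace_mul_mono {P P' Q : Matrix ι ι ℂ} (hP : (P' - P).PosSemidef) (hQ : Q.PosSemidef) :
    (trace (P * Q)).re ≤ (trace (P' * Q)).re := by
  have h := trace_mul_psd_nonneg hP hQ
  rw [Matrix.sub_mul, trace_sub, Complex.sub_re] at h
  linarith

lemma log_det_le_trace {P : Matrix ι ι ℂ} (hP : P.PosDef) :
    Real.log P.det.re ≤ (trace P).re - Fintype.card ι := by
  have h1 := hP.1.det_eq_prod_eigenvalues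
  have h2 := hP.1.trace_eq_sum_eigenvalues
  have h3 : P.det.re = ∏ i, hP.1.eigenvalues i := by
    rw [h1]
    exact_mod_cast Complex.ofReal_re (∏ i, hP.1.eigenvalues i)
  have h4 : (trace P).re = ∑ i, hP.1.eigenvalues i := by
    rw [h2]
    exact_mod_cast Complex.ofReal_re (∑ i, hP.1.eigenvalues i)
  rw [h3, h4, Real.log_prod (fun i _ => (hP.eigenvalues_pos i).ne')]
  calc ∑ i, Real.log (hP.1.eigenvalues i) ≤ ∑ i, (hP.1.eigenvalues i - 1) :=
        Finset.sum_le_sum fun i _ => Real.log_le_sub_one_of_pos (hP.eigenvalues_pos i)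
    _ = _ := by simp

lemma logdet_sub_le {X Y : Matrix ι ι ℂ} (hX : X.PosDef) (hY : Y.PosDef) :
    Real.log X.det.re - Real.log Y.det.re ≤ (trace (Y⁻¹ * (X - Y))).re := by
  obtain ⟨B, hB⟩ := psd_factor hY.inv.posSemidef
  have hXd := Complex.lt_def.1 hX.det_pos
  have hYd := Complex.lt_def.1 hY.inv.det_pos
  have hYd' := Complex.lt_def.1 hY.det_pos
  have hdet : (B * X * Bᴴ).det = Y⁻¹.det * X.det := by
    rw [hB]; simp only [det_mul]; ring
  have hpd : (B * X * Bᴴ).PosDef := by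
    rw [(hX.posSemidef.mul_mul_conjTranspose_same B).posDef_iff_det_ne_zero, hdet]
    exact mul_ne_zero hY.inv.det_pos.ne' hX.det_pos.ne'
  have h := log_det_le_trace hpd
  have hinv : Y⁻¹ * Y = 1 := nonsing_inv_mul _ (isUnit_iff_ne_zero.2 hY.det_pos.ne')
  have hd : Y⁻¹.det * Y.det = 1 := by rw [← det_mul, hinv, det_one]
  have hd' : Y⁻¹.det.re * Y.det.re = 1 := by
    have := congrArg Complex.re hd
    rw [Complex.mul_re, ← hYd.2, Complex.one_re] at this
    simpa using this
  have ht : trace (B * X * Bᴴ) = trace (Y⁻¹ * X) := by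
    rw [hB, Matrix.trace_mul_comm, ← Matrix.mul_assoc]
  have hl : Real.log Y⁻¹.det.re + Real.log Y.det.re = 0 := by
    rw [← Real.log_mul hYd.1.ne' hYd'.1.ne', hd', Real.log_one]
  rw [hdet, ht, Complex.mul_re, ← hYd.2, Complex.zero_im, zero_mul, sub_zero,
    Real.log_mul hYd.1.ne' hXd.1.ne'] at h
  rw [Matrix.mul_sub, hinv, trace_sub, trace_one, Complex.sub_re, Complex.natCast_re]
  linarith

lemma one_sub_inv_psd {Z : Matrix ι ι ℂ} (hZ : Z.PosSemidef) : (1 - (1 + Z)⁻¹).PosSemidef := by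
  have hY : (1 + Z).PosDef := PosDef.one.add_posSemidef hZ
  have hu := isUnit_iff_ne_zero.2 hY.det_pos.ne'
  have h1 : (1 + Z)⁻¹ * (1 + Z) = 1 := nonsing_inv_mul _ hu
  have h2 : (1 + Z) * (1 + Z)⁻¹ = 1 := mul_nonsing_inv _ hu
  have h := (hZ.add (posSemidef_conjTranspose_mul_self Z)).mul_mul_conjTranspose_same (1 + Z)⁻¹
  rw [hY.inv.1, hZ.1] at h
  have e : (1 + Z)⁻¹ * (Z + Z * Z) * (1 + Z)⁻¹ = 1 - (1 + Z)⁻¹ := by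
    have : Z + Z * Z = (1 + Z) * Z := by noncomm_ring
    rw [this, ← Matrix.mul_assoc, h1, Matrix.one_mul]
    have : Z = (1 + Z) - 1 := by simp
    conv_lhs => enter [1]; rw [this]
    rw [Matrix.sub_mul, h2, Matrix.one_mul]
  rwa [e] at h

lemma trace_inv_lower {Z Z' Δ : Matrix ι ι ℂ} (hZ : Z.PosSemidef) (hZ' : Z'.PosSemidef)
    (hΔ : Δ.IsHermitian) {s : ℝ} (hs : 0 ≤ s) (h : Z' = Z + (s : ℂ) • Δ) :
    (trace ((1 + Z)⁻¹ * Δ)).re - s * (trace (Δ * Δ)).re ≤ (trace ((1 + Z')⁻¹ * Δ)).re := by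
  have hX : (1 + Z).PosDef := PosDef.one.add_posSemidef hZ
  have hY : (1 + Z').PosDef := PosDef.one.add_posSemidef hZ'
  have hu := isUnit_iff_ne_zero.2 hX.det_pos.ne'
  have hu' := isUnit_iff_ne_zero.2 hY.det_pos.ne'
  have e : (1 + Z)⁻¹ - (1 + Z')⁻¹ = (s : ℂ) • ((1 + Z')⁻¹ * Δ * (1 + Z)⁻¹) := by
    have e1 : (1 + Z')⁻¹ * ((1 + Z') - (1 + Z)) * (1 + Z)⁻¹ = (1 + Z)⁻¹ - (1 + Z')⁻¹ := by
      rw [Matrix.mul_sub, nonsing_inv_mul _ hu', Matrix.sub_mul, Matrix.mul_assoc,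
        mul_nonsing_inv _ hu, Matrix.one_mul, Matrix.mul_one]
    have e2 : (1 + Z') - (1 + Z) = (s : ℂ) • Δ := by rw [h]; abel
    rw [← e1, e2, Matrix.mul_smul, Matrix.smul_mul]
  have e3 : (trace ((1 + Z)⁻¹ * Δ)).re - (trace ((1 + Z')⁻¹ * Δ)).re
      = s * (trace ((1 + Z')⁻¹ * (Δ * (1 + Z)⁻¹ * Δ))).re := by
    rw [← Complex.sub_re, ← trace_sub, ← Matrix.sub_mul, e, Matrix.smul_mul, trace_smul,
      smul_eq_mul, Complex.re_ofReal_mul]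
    simp only [Matrix.mul_assoc]
  have p1 : (Δ * (1 + Z)⁻¹ * Δ).PosSemidef := by
    have := hX.inv.posSemidef.mul_mul_conjTranspose_same Δ
    rwa [hΔ] at this
  have p2 : (Δ * Δ).PosSemidef := by
    have := posSemidef_conjTranspose_mul_self Δ
    rwa [hΔ] at this
  have i1 := trace_mul_mono (one_sub_inv_psd hZ') p1
  have i2 := trace_mul_mono (one_sub_inv_psd hZ) p2
  rw [Matrix.one_mul] at i1 i2
  have e4 : trace (Δ * (1 + Z)⁻¹ * Δ) = trace ((1 + Z)⁻¹ * (Δ * Δ)) := by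
    rw [Matrix.mul_assoc, Matrix.trace_mul_comm, Matrix.mul_assoc]
  rw [e4] at i1
  have := mul_le_mul_of_nonneg_left (i1.trans i2) hs
  linarith

lemma logdet_quadratic {Z Z' : Matrix ι ι ℂ} (hZ : Z.PosSemidef) (hZ' : Z'.PosSemidef) :
    Real.log (1 + Z).det.re + (trace ((1 + Z)⁻¹ * (Z' - Z))).re
      - (1 / 2) * (trace ((Z' - Z) * (Z' - Z))).re ≤ Real.log (1 + Z').det.re := by
  set Δ := Z' - Z with hΔdef
  have hΔ : Δ.IsHermitian := hZ'.1.sub hZ.1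
  set C := (trace (Δ * Δ)).re with hC
  let W : ℝ → Matrix ι ι ℂ := fun s => Z + (s : ℂ) • Δ
  have hW : ∀ s : ℝ, 0 ≤ s → s ≤ 1 → (W s).PosSemidef := by
    intro s h0 h1
    have e : W s = ((1 - s : ℝ) : ℂ) • Z + (s : ℂ) • Z' := by
      simp only [W, hΔdef, Complex.ofReal_sub, Complex.ofReal_one, smul_sub, sub_smul, one_smul]
      abel
    rw [e]
    refine (hZ.smul ?_).add (hZ'.smul ?_)
    · exact_mod_cast sub_nonneg.2 h1
    · exact_mod_cast h0
  let f : ℝ → ℝ := fun s => Real.log (1 + W s).det.re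
  have hstep : ∀ s t : ℝ, 0 ≤ s → s ≤ t → t ≤ 1 →
      f s + (t - s) * ((trace ((1 + Z)⁻¹ * Δ)).re - t * C) ≤ f t := by
    intro s t h0 hst h1
    have a := logdet_sub_le (PosDef.one.add_posSemidef (hW s h0 (hst.trans h1)))
      (PosDef.one.add_posSemidef (hW t (h0.trans hst) h1))
    have e : (1 + W s) - (1 + W t) = ((s - t : ℝ) : ℂ) • Δ := by
      simp only [W, Complex.ofReal_sub, sub_smul]; abel
    rw [e, Matrix.mul_smul, trace_smul, smul_eq_mul, Complex.re_ofReal_mul] at a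
    have b := trace_inv_lower hZ (hW t (h0.trans hst) h1) hΔ (h0.trans hst) rfl
    have c := mul_le_mul_of_nonneg_left b (sub_nonneg.2 hst)
    change f s - f t ≤ _ at a
    linarith
  have hf0 : f 0 = Real.log (1 + Z).det.re := by simp [f, W]
  have hf1 : f 1 = Real.log (1 + Z').det.re := by simp [f, W, hΔdef]
  set g := (trace ((1 + Z)⁻¹ * Δ)).re with hg
  have hind : ∀ k : ℕ, 0 < k → ∀ j : ℕ, j ≤ k →
      f 0 + (j / k : ℝ) * g - C * (j * (j + 1)) / (2 * k ^ 2) ≤ f (j / k) := by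
    intro k hk j
    have hk' : (0 : ℝ) < k := by exact_mod_cast hk
    induction j with
    | zero => intro _; simp
    | succ j ih =>
      intro hj
      have a := ih (by omega)
      have b := hstep (j / k) ((j + 1 : ℕ) / k) (by positivity)
        (by gcongr; omega) (by rw [div_le_one hk']; exact_mod_cast hj)
      refine le_trans (le_of_eq ?_) ((add_le_add_left a _).trans b)
      push_cast
      field_simp
      ring
  rw [← hf0, ← hf1]
  have hlim : ∀ k : ℕ, 0 < k → f 0 + g - (1 / 2) * C - f 1 ≤ (C / 2) * (1 / (k : ℝ)) := by
    intro k hk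
    have hk' : (0 : ℝ) < k := by exact_mod_cast hk
    have a := hind k hk k le_rfl
    rw [div_self hk'.ne'] at a
    have e : C * (k * (k + 1)) / (2 * k ^ 2) = C / 2 + (C / 2) * (1 / (k : ℝ)) := by
      field_simp
    rw [e] at a
    linarith
  have ht : Filter.Tendsto (fun k : ℕ => (C / 2) * (1 / (k : ℝ))) Filter.atTop (nhds (C / 2 * 0)) :=
    tendsto_one_div_atTop_nhds_zero_nat.const_mul _
  have := ge_of_tendsto ht (Filter.eventually_atTop.2 ⟨1, fun k hk => hlim k hk⟩)
  linarith

lemma smul_one_sub_psd {K : Matrix ι ι ℂ} (hK : K.IsHermitian) :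
    (((⨆ j, hK.eigenvalues j : ℝ) : ℂ) • (1 : Matrix ι ι ℂ) - K).PosSemidef := by
  set l := ⨆ j, hK.eigenvalues j
  have hd : (diagonal (fun j => ((l - hK.eigenvalues j : ℝ) : ℂ))).PosSemidef := by
    refine PosSemidef.diagonal fun j => ?_
    have : hK.eigenvalues j ≤ l := le_ciSup (Set.finite_range _).bddAbove j
    change (0 : ℂ) ≤ ((l - hK.eigenvalues j : ℝ) : ℂ)
    exact_mod_cast sub_nonneg.2 this
  have h := hd.mul_mul_conjTranspose_same (hK.eigenvectorUnitary : Matrix ι ι ℂ)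
  have hs := hK.spectral_theorem
  rw [Unitary.conjStarAlgAut_apply] at hs
  have hU : (hK.eigenvectorUnitary : Matrix ι ι ℂ) * (hK.eigenvectorUnitary : Matrix ι ι ℂ)ᴴ = 1 :=
    Unitary.coe_mul_star_self hK.eigenvectorUnitary
  have e : diagonal (fun j => ((l - hK.eigenvalues j : ℝ) : ℂ))
      = (l : ℂ) • (1 : Matrix ι ι ℂ) - diagonal (RCLike.ofReal ∘ hK.eigenvalues) := by
    rw [smul_one_eq_diagonal, diagonal_sub]
    congr 1
    funext j
    simp
  rw [e, Matrix.mul_sub, Matrix.sub_mul, Matrix.mul_smul, Matrix.smul_mul, Matrix.mul_one, hU] at h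
  convert h using 2
  exact hs

lemma frob_conj_le {κ : Type*} [Fintype κ] [DecidableEq κ] (H : Matrix κ ι ℂ)
    {D : Matrix ι ι ℂ} (hD : D.IsHermitian) :
    (trace ((H * D * Hᴴ) * (H * D * Hᴴ))).re ≤
      (⨆ j, (isHermitian_mul_conjTranspose_self Hᴴ).eigenvalues j) ^ 2 * (trace (Dᴴ * D)).re := by
  have hp : (Hᴴ * Hᴴᴴ).PosSemidef := posSemidef_self_mul_conjTranspose Hᴴ
  have hm := smul_one_sub_psd (isHermitian_mul_conjTranspose_self Hᴴ)
  set l := ⨆ j, (isHermitian_mul_conjTranspose_self Hᴴ).eigenvalues j with hl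
  have hl0 : 0 ≤ l := Real.iSup_nonneg fun j => hp.eigenvalues_nonneg j
  have p1 : (D * (Hᴴ * Hᴴᴴ) * D).PosSemidef := by
    have := hp.mul_mul_conjTranspose_same D
    rwa [hD] at this
  have p2 : (D * D).PosSemidef := by
    have := posSemidef_conjTranspose_mul_self D
    rwa [hD] at this
  have i1 := trace_mul_mono hm p1
  have i2 := trace_mul_mono hm p2
  rw [Matrix.smul_mul, Matrix.one_mul, trace_smul, smul_eq_mul, Complex.re_ofReal_mul] at i1 i2
  have e1 : trace ((H * D * Hᴴ) * (H * D * Hᴴ)) = trace (Hᴴ * Hᴴᴴ * (D * (Hᴴ * Hᴴᴴ) * D)) := by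
    rw [conjTranspose_conjTranspose]
    have : (H * D * Hᴴ) * (H * D * Hᴴ) = (H * D * Hᴴ * H * D) * Hᴴ := by
      simp only [Matrix.mul_assoc]
    rw [this, Matrix.trace_mul_comm]
    simp only [Matrix.mul_assoc]
  have e2 : trace (D * (Hᴴ * Hᴴᴴ) * D) = trace (Hᴴ * Hᴴᴴ * (D * D)) := by
    rw [Matrix.mul_assoc, Matrix.trace_mul_comm, Matrix.mul_assoc]
  rw [e1, hD]
  rw [e2] at i1
  have := mul_le_mul_of_nonneg_left i2 hl0
  nlinarith

lemma trace_frob (D : Matrix ι ι ℂ) : (trace (Dᴴ * D)).re = ∑ i, ∑ j, ‖D j i‖ ^ 2 := by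
  simp only [trace, diag_apply, Matrix.mul_apply, conjTranspose_apply, Complex.re_sum]
  refine Finset.sum_congr rfl fun i _ => Finset.sum_congr rfl fun j _ => ?_
  rw [Complex.star_def, mul_comm, Complex.mul_conj, Complex.ofReal_re, Complex.normSq_eq_norm_sq]

lemma trace_frob_sum {N : ℕ} (D : Fin N → Matrix ι ι ℂ) :
    (trace ((∑ l, D l)ᴴ * (∑ l, D l))).re ≤ N * ∑ l, (trace ((D l)ᴴ * D l)).re := by
  simp only [trace_frob]
  rw [Finset.sum_comm (s := (Finset.univ : Finset (Fin N))), Finset.mul_sum]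
  refine Finset.sum_le_sum fun i _ => ?_
  rw [Finset.sum_comm (s := (Finset.univ : Finset (Fin N))), Finset.mul_sum]
  refine Finset.sum_le_sum fun j _ => ?_
  rw [Matrix.sum_apply]
  have h1 : ‖∑ l, D l j i‖ ^ 2 ≤ (∑ l, ‖D l j i‖) ^ 2 := by
    gcongr; exact norm_sum_le _ _
  have h2 := sq_sum_le_card_mul_sum_sq (s := (Finset.univ : Finset (Fin N)))
    (f := fun l => ‖D l j i‖)
  simpa using h1.trans h2

end helpers


/-- Multi-block quadratic minorant (Proposition 3): for each user `i` with channel `H i` and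
`ξ i ≥ (1/2) N² λ_max((H i)ᴴ(H i))²`, and all N-tuples of Hermitian PSD matrices `S, S₀`,
`log det(I + H_i (Σ_k S_k) H_iᴴ) ≥ log det(I + H_i (Σ_k S_k⁰) H_iᴴ)
 + Σ_ℓ Re Tr(G_i (S_ℓ − S_ℓ⁰)) − ξ_i Σ_ℓ Tr((S_ℓ − S_ℓ⁰)ᴴ(S_ℓ − S_ℓ⁰))`. -/
theorem multiblock_quadratic_surrogate_minorant
    {N n : ℕ} (m : Fin N → ℕ) (H : ∀ i, Matrix (Fin (m i)) (Fin n) ℂ) (ξ : Fin N → ℝ)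
    (hξ : ∀ i, (1 / 2) * (N : ℝ) ^ 2 *
        (⨆ j, (isHermitian_mul_conjTranspose_self (H i)ᴴ).eigenvalues j) ^ 2 ≤ ξ i)
    (S S₀ : Fin N → Matrix (Fin n) (Fin n) ℂ)
    (hS : ∀ ℓ, (S ℓ).PosSemidef) (hS₀ : ∀ ℓ, (S₀ ℓ).PosSemidef) (i : Fin N) :
    Real.log ((1 + H i * (∑ k, S₀ k) * (H i)ᴴ).det.re) +
        (∑ ℓ, (Matrix.trace
            (((H i)ᴴ * (1 + H i * (∑ k, S₀ k) * (H i)ᴴ)⁻¹ * H i) * (S ℓ - S₀ ℓ))).re) -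
        ξ i * ∑ ℓ, (Matrix.trace ((S ℓ - S₀ ℓ)ᴴ * (S ℓ - S₀ ℓ))).re ≤
      Real.log ((1 + H i * (∑ k, S k) * (H i)ᴴ).det.re) := by
  have hZ : (H i * (∑ k, S k) * (H i)ᴴ).PosSemidef :=
    (posSemidef_sum _ fun k _ => hS k).mul_mul_conjTranspose_same _
  have hZ₀ : (H i * (∑ k, S₀ k) * (H i)ᴴ).PosSemidef :=
    (posSemidef_sum _ fun k _ => hS₀ k).mul_mul_conjTranspose_same _
  have h := logdet_quadratic hZ₀ hZ
  have eD : H i * (∑ k, S k) * (H i)ᴴ - H i * (∑ k, S₀ k) * (H i)ᴴ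
      = H i * (∑ k, (S k - S₀ k)) * (H i)ᴴ := by
    rw [Finset.sum_sub_distrib, Matrix.mul_sub, Matrix.sub_mul]
  rw [eD] at h
  have hD : (∑ k, (S k - S₀ k)).IsHermitian := by
    rw [Finset.sum_sub_distrib]
    exact (posSemidef_sum _ fun k _ => hS k).1.sub (posSemidef_sum _ fun k _ => hS₀ k).1
  have h1 := frob_conj_le (H i) hD
  have h2 := trace_frob_sum fun k => S k - S₀ k
  have h3 := hξ i
  set l := ⨆ j, (isHermitian_mul_conjTranspose_self (H i)ᴴ).eigenvalues j with hl
  have hF : 0 ≤ ∑ k, (trace ((S k - S₀ k)ᴴ * (S k - S₀ k))).re := by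
    refine Finset.sum_nonneg fun k _ => ?_
    rw [trace_frob]
    positivity
  have eT : (∑ ℓ, (Matrix.trace
      (((H i)ᴴ * (1 + H i * (∑ k, S₀ k) * (H i)ᴴ)⁻¹ * H i) * (S ℓ - S₀ ℓ))).re)
      = (trace ((1 + H i * (∑ k, S₀ k) * (H i)ᴴ)⁻¹ *
          (H i * (∑ k, (S k - S₀ k)) * (H i)ᴴ))).re := by
    rw [← Complex.re_sum, ← trace_sum, ← Finset.mul_sum, ← Matrix.mul_assoc, ← Matrix.mul_assoc,
      Matrix.trace_mul_comm _ (H i)ᴴ]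
    simp only [Matrix.mul_assoc]
  rw [eT]
  set F := ∑ k, (trace ((S k - S₀ k)ᴴ * (S k - S₀ k))).re with hFdef
  have hN : (1 : ℝ) ≤ N := by
    have : 0 < N := i.pos
    exact_mod_cast this
  have hN2 : (N : ℝ) * F ≤ (N : ℝ) ^ 2 * F := by
    refine mul_le_mul_of_nonneg_right ?_ hF
    nlinarith
  have h4 := mul_le_mul_of_nonneg_left (h2.trans hN2) (sq_nonneg l)
  have h5 := mul_le_mul_of_nonneg_right h3 hF
  have h6 : l ^ 2 * ((N : ℝ) ^ 2 * F) = 2 * ((1 / 2) * (N : ℝ) ^ 2 * l ^ 2 * F) := by ring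
  have h7 := h1.trans h4
  linarith
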